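/- arXiv:2310.03613 — 7 statements merged into one kernel-verified Lean document; each statement's English description precedes it below -/
import Mathlib

section
/- Let G₁, …, G_N : E → H be maps between real inner product spaces, each L_f-Lipschitz, and let Ḡ = (1/N)∑_{i=1}^N G_i. Let z₁, …, z_N ∈ E with mean z̄ = (1/N)∑_i z_i, and suppose (1/N)∑_{i=1}^N ‖G_i(z̄) − Ḡ(z̄)‖² ≤ ζ². Then ∑_{i=1}^N ‖G_i(z_i) − (1/N)∑_{j=1}^N G_j(z_j)‖² ≤ 6 L_f² ∑_{i=1}^N ‖z_i − z̄‖² + 3Nζ². -/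
/-- The squared norm of a three-term combination `a - m + b` is at most three times the sum of the
squared norms. -/
theorem norm_sub_add_sq_le_three_mul {H : Type*} [SeminormedAddCommGroup H] (a m b : H) :
    ‖a - m + b‖ ^ 2 ≤ 3 * (‖a‖ ^ 2 + ‖m‖ ^ 2 + ‖b‖ ^ 2) := by
  have h : ‖a - m + b‖ ≤ ‖a‖ + ‖m‖ + ‖b‖ :=
    (norm_add_le _ _).trans (by gcongr; exact norm_sub_le a m)
  have h2 := pow_le_pow_left₀ (norm_nonneg _) h 2
  nlinarith [sq_nonneg (‖a‖ - ‖m‖), sq_nonneg (‖a‖ - ‖b‖), sq_nonneg (‖m‖ - ‖b‖)]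

/-- Jensen's inequality for the squared norm of a mean. -/
theorem card_mul_norm_mean_sq_le {H : Type*} [SeminormedAddCommGroup H] [NormedSpace ℝ H]
    {N : ℕ} (hN : 0 < N) (a : Fin N → H) :
    N * ‖(N : ℝ)⁻¹ • ∑ i, a i‖ ^ 2 ≤ ∑ i, ‖a i‖ ^ 2 := by
  have hN' : (0 : ℝ) < N := by exact_mod_cast hN
  have h : ‖∑ i, a i‖ ^ 2 ≤ N * ∑ i, ‖a i‖ ^ 2 :=
    (pow_le_pow_left₀ (norm_nonneg _) (norm_sum_le _ _) 2).trans
      (by simpa using sq_sum_le_card_mul_sum_sq (s := Finset.univ) (f := fun i => ‖a i‖))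
  calc N * ‖(N : ℝ)⁻¹ • ∑ i, a i‖ ^ 2 = (N : ℝ)⁻¹ * ‖∑ i, a i‖ ^ 2 := by
        rw [norm_smul, Real.norm_of_nonneg (by positivity)]
        field_simp
    _ ≤ (N : ℝ)⁻¹ * (N * ∑ i, ‖a i‖ ^ 2) := by gcongr
    _ = ∑ i, ‖a i‖ ^ 2 := by field_simp

/-- If `G 1, …, G N : E → H` are `L_f`-Lipschitz maps with average `Ḡ`, and the points
`z 1, …, z N` have mean `z̄`, and the heterogeneity bound
`(1/N) ∑ i, ‖G i z̄ - Ḡ z̄‖² ≤ ζ²` holds, then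
`∑ i, ‖G i (z i) - (1/N) ∑ j, G j (z j)‖² ≤ 6 L_f² ∑ i, ‖z i - z̄‖² + 3 N ζ²`. -/
theorem heterogeneous_gradient_deviation_bound
    {E H : Type*} [NormedAddCommGroup E] [InnerProductSpace ℝ E]
    [NormedAddCommGroup H] [InnerProductSpace ℝ H]
    {N : ℕ} (hN : 0 < N) (G : Fin N → E → H) (L_f ζ : ℝ)
    (hLip : ∀ i, ∀ z₁ z₂ : E, ‖G i z₁ - G i z₂‖ ≤ L_f * ‖z₁ - z₂‖)
    (z : Fin N → E)
    (hhet : (N : ℝ)⁻¹ * ∑ i, ‖G i ((N : ℝ)⁻¹ • ∑ j, z j)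
        - (N : ℝ)⁻¹ • ∑ j, G j ((N : ℝ)⁻¹ • ∑ k, z k)‖ ^ 2 ≤ ζ ^ 2) :
    ∑ i, ‖G i (z i) - (N : ℝ)⁻¹ • ∑ j, G j (z j)‖ ^ 2
      ≤ 6 * L_f ^ 2 * ∑ i, ‖z i - (N : ℝ)⁻¹ • ∑ j, z j‖ ^ 2 + 3 * N * ζ ^ 2 := by
  have hN' : (0 : ℝ) < N := by exact_mod_cast hN
  set c := (N : ℝ)⁻¹ • ∑ j, z j
  have hdrift : ∑ i, ‖G i (z i) - G i c‖ ^ 2 ≤ L_f ^ 2 * ∑ i, ‖z i - c‖ ^ 2 := by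
    rw [Finset.mul_sum]
    refine Finset.sum_le_sum fun i _ => ?_
    rw [← mul_pow]
    exact pow_le_pow_left₀ (norm_nonneg _) (hLip i _ _) 2
  have hmean := card_mul_norm_mean_sq_le hN fun i => G i (z i) - G i c
  have hhet' := (inv_mul_le_iff₀ hN').1 hhet
  have hsum : ∑ i, ‖G i (z i) - (N : ℝ)⁻¹ • ∑ j, G j (z j)‖ ^ 2
      ≤ ∑ i, 3 * (‖G i (z i) - G i c‖ ^ 2 + ‖(N : ℝ)⁻¹ • ∑ j, (G j (z j) - G j c)‖ ^ 2
        + ‖G i c - (N : ℝ)⁻¹ • ∑ j, G j c‖ ^ 2) := by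
    refine Finset.sum_le_sum fun i _ => ?_
    refine le_of_eq_of_le ?_ (norm_sub_add_sq_le_three_mul _ _ _)
    rw [Finset.sum_sub_distrib, smul_sub]
    congr 2
    abel
  rw [← Finset.mul_sum, Finset.sum_add_distrib, Finset.sum_add_distrib, Finset.sum_const,
    Finset.card_univ, Fintype.card_fin, nsmul_eq_mul] at hsum
  linarith
end

section
/- Let E and F be finite-dimensional real inner product spaces and let F : E × F → ℝ be differentiable with L_f-Lipschitz gradient, such that y ↦ F(x,y) is μ-strongly concave for every x, with unique maximizer y*(x), and let Φ(x) = F(x, y*(x)) = max_y F(x,y). Then for all x ∈ E and y ∈ F, ‖∇_x F(x, y*(x)) − ∇_x F(x,y)‖² ≤ (2L_f²/μ)(Φ(x) − F(x,y)). -/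
open RealInnerProductSpace

/-- The gradient of a function vanishes at a local maximum. -/
theorem IsLocalMax.hasGradientAt_eq_zero {F : Type*} [NormedAddCommGroup F]
    [InnerProductSpace ℝ F] [CompleteSpace F] {f : F → ℝ} {f' a : F}
    (h : IsLocalMax f a) (hf : HasGradientAt f f' a) : f' = 0 :=
  (InnerProductSpace.toDual ℝ F).map_eq_zero_iff.mp (h.hasFDerivAt_eq_zero hf.hasFDerivAt)

/-- For `F : E × F → ℝ` differentiable with `L_f`-Lipschitz gradient and `μ`-strongly concave
in `y` with maximizer `y*(x)` and `Φ(x) = F(x, y*(x))`, one has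
`‖∇ₓF(x, y*(x)) - ∇ₓF(x,y)‖² ≤ (2L_f²/μ)(Φ(x) - F(x,y))`. -/
theorem grad_gap_sq_le_duality_gap
    {E F : Type*} [NormedAddCommGroup E] [InnerProductSpace ℝ E] [FiniteDimensional ℝ E]
    [NormedAddCommGroup F] [InnerProductSpace ℝ F] [FiniteDimensional ℝ F]
    (G : E → F → ℝ) (gx : E → F → E) (gy : E → F → F) (L_f μ : ℝ) (hμ : 0 < μ)
    (hgx : ∀ x y, HasGradientAt (fun x' => G x' y) (gx x y) x)
    (hgy : ∀ x y, HasGradientAt (fun y' => G x y') (gy x y) y)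
    (hLip : ∀ x₁ y₁ x₂ y₂, ‖gx x₁ y₁ - gx x₂ y₂‖ ^ 2 + ‖gy x₁ y₁ - gy x₂ y₂‖ ^ 2
      ≤ L_f ^ 2 * (‖x₁ - x₂‖ ^ 2 + ‖y₁ - y₂‖ ^ 2))
    (hsc : ∀ x y y', G x y' ≤ G x y + ⟪gy x y, y' - y⟫ - μ / 2 * ‖y' - y‖ ^ 2)
    (ystar : E → F)
    (hmax : ∀ x y, G x y ≤ G x (ystar x))
    (huniq : ∀ x y, (∀ y', G x y' ≤ G x y) → y = ystar x) :
    ∀ (x : E) (y : F), ‖gx x (ystar x) - gx x y‖ ^ 2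
      ≤ 2 * L_f ^ 2 / μ * (G x (ystar x) - G x y) := by
  intro x y
  have hzero : gy x (ystar x) = 0 :=
    IsLocalMax.hasGradientAt_eq_zero (Filter.Eventually.of_forall (hmax x)) (hgy x (ystar x))
  have hgrowth : μ / 2 * ‖ystar x - y‖ ^ 2 ≤ G x (ystar x) - G x y := by
    have h := hsc x (ystar x) y
    rw [hzero, inner_zero_left, norm_sub_rev] at h
    linarith
  have hlip : ‖gx x (ystar x) - gx x y‖ ^ 2 ≤ L_f ^ 2 * ‖ystar x - y‖ ^ 2 := by
    have h := hLip x (ystar x) x y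
    rw [sub_self x, norm_zero] at h
    linarith [sq_nonneg ‖gy x (ystar x) - gy x y‖]
  calc ‖gx x (ystar x) - gx x y‖ ^ 2 ≤ L_f ^ 2 * ‖ystar x - y‖ ^ 2 := hlip
    _ = 2 * L_f ^ 2 / μ * (μ / 2 * ‖ystar x - y‖ ^ 2) := by field_simp
    _ ≤ 2 * L_f ^ 2 / μ * (G x (ystar x) - G x y) := by gcongr
end

section
/- Let E and F be finite-dimensional real inner product spaces, let F : E × F → ℝ be differentiable with L_f-Lipschitz gradient, let Φ(x) = sup_y F(x,y) be finite for every x, and suppose F satisfies the μ-PL condition in y: ‖∇_y F(x,y)‖² ≥ 2μ(Φ(x) − F(x,y)) for all x, y. Then for any x, x⁺ ∈ E, y ∈ F, v ∈ F, and constants c, η > 0, setting y⁺ = y + cηv, one has Φ(x⁺) − F(x⁺, y⁺) ≤ (1 − cημ)(Φ(x⁺) − F(x⁺, y)) − ((cη − L_f c²η²)/2)‖v‖² + cη(L_f²‖x⁺ − x‖² + ‖∇_y F(x,y) − v‖²). -/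
open RealInnerProductSpace

/-- The quadratic lower bound for a function whose gradient is Lipschitz at the base point `y`. -/
theorem quadratic_lower_bound_of_lipschitz_gradient
    {F : Type*} [NormedAddCommGroup F] [InnerProductSpace ℝ F] [CompleteSpace F]
    {f : F → ℝ} {g : F → F} {L : ℝ} {y : F}
    (hg : ∀ z, HasGradientAt f (g z) z) (hL : ∀ z, ‖g z - g y‖ ≤ L * ‖z - y‖) (w : F) :
    f y + ⟪g y, w⟫ - L / 2 * ‖w‖ ^ 2 ≤ f (y + w) := by
  have hline (s : ℝ) : HasDerivAt (fun s : ℝ => y + s • w) w s := by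
    simpa using ((hasDerivAt_id s).smul_const w).const_add y
  have hderiv (s : ℝ) :
      HasDerivAt (fun s : ℝ => f (y + s • w) - s * ⟪g y, w⟫ + s ^ 2 * (L / 2 * ‖w‖ ^ 2))
        (⟪g (y + s • w) - g y, w⟫ + s * (L * ‖w‖ ^ 2)) s := by
    have hcomp := (hg (y + s • w)).hasFDerivAt.comp_hasDerivAt s (hline s)
    have h := (hcomp.sub ((hasDerivAt_id s).mul_const ⟪g y, w⟫)).add
      ((hasDerivAt_pow 2 s).mul_const (L / 2 * ‖w‖ ^ 2))
    refine h.congr_deriv ?_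
    simp only [InnerProductSpace.toDual_apply_apply, inner_sub_left]
    push_cast
    ring
  have hmono : MonotoneOn
      (fun s : ℝ => f (y + s • w) - s * ⟪g y, w⟫ + s ^ 2 * (L / 2 * ‖w‖ ^ 2)) (Set.Ici 0) := by
    refine monotoneOn_of_hasDerivWithinAt_nonneg (convex_Ici 0)
      (fun s _ => (hderiv s).continuousAt.continuousWithinAt)
      (fun s _ => (hderiv s).hasDerivWithinAt) fun s hs => ?_
    rw [interior_Ici] at hs
    have hnorm : ‖g (y + s • w) - g y‖ ≤ L * (s * ‖w‖) := by
      simpa [norm_smul, abs_of_pos (Set.mem_Ioi.mp hs)] using hL (y + s • w)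
    have hinner := neg_le_of_abs_le (abs_real_inner_le_norm (g (y + s • w) - g y) w)
    have := mul_le_mul_of_nonneg_right hnorm (norm_nonneg w)
    linarith
  have h := hmono Set.self_mem_Ici (Set.mem_Ici.mpr zero_le_one) zero_le_one
  simp only [zero_smul, one_smul, add_zero] at h
  linarith

/-- One-step ascent inequality: under `L_f`-smoothness of `F` and the `μ`-PL condition in `y`,
the update `y⁺ = y + cηv` satisfies
`Φ(x⁺) - F(x⁺, y⁺) ≤ (1 - cημ)(Φ(x⁺) - F(x⁺, y)) - ((cη - L_f c²η²)/2)‖v‖²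
  + cη(L_f²‖x⁺ - x‖² + ‖∇_y F(x,y) - v‖²)`. -/
theorem one_step_ascent_inequality
    {E F : Type*} [NormedAddCommGroup E] [InnerProductSpace ℝ E] [FiniteDimensional ℝ E]
    [NormedAddCommGroup F] [InnerProductSpace ℝ F] [FiniteDimensional ℝ F]
    (G : E → F → ℝ) (gx : E → F → E) (gy : E → F → F) (L_f μ : ℝ)
    (hLf : 0 < L_f) (hμ : 0 < μ)
    (hgx : ∀ x y, HasGradientAt (fun x' => G x' y) (gx x y) x)
    (hgy : ∀ x y, HasGradientAt (fun y' => G x y') (gy x y) y)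
    (hLip : ∀ x₁ y₁ x₂ y₂, ‖gx x₁ y₁ - gx x₂ y₂‖ ^ 2 + ‖gy x₁ y₁ - gy x₂ y₂‖ ^ 2
      ≤ L_f ^ 2 * (‖x₁ - x₂‖ ^ 2 + ‖y₁ - y₂‖ ^ 2))
    (Φ : E → ℝ)
    (hbdd : ∀ x, BddAbove (Set.range (G x)))
    (hΦ : ∀ x, Φ x = ⨆ y, G x y)
    (hPL : ∀ x y, 2 * μ * (Φ x - G x y) ≤ ‖gy x y‖ ^ 2) :
    ∀ (x xp : E) (y v : F) (c η : ℝ), 0 < c → 0 < η →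
      Φ xp - G xp (y + (c * η) • v)
        ≤ (1 - c * η * μ) * (Φ xp - G xp y)
          - (c * η - L_f * c ^ 2 * η ^ 2) / 2 * ‖v‖ ^ 2
          + c * η * (L_f ^ 2 * ‖xp - x‖ ^ 2 + ‖gy x y - v‖ ^ 2) := by
  intro x xp y v c η hc hη
  have hgrad (z : F) : ‖gy xp z - gy xp y‖ ≤ L_f * ‖z - y‖ := by
    refine le_of_sq_le_sq ?_ (by positivity)
    simpa [mul_pow] using (le_add_of_nonneg_left (sq_nonneg _)).trans (hLip xp z xp y)
  have hascent := quadratic_lower_bound_of_lipschitz_gradient (hgy xp) hgrad ((c * η) • v)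
  rw [real_inner_smul_right, norm_smul, mul_pow, Real.norm_eq_abs, sq_abs] at hascent
  have hpolar := norm_sub_sq_real (gy xp y) v
  have hshift : ‖gy xp y - gy x y‖ ^ 2 ≤ L_f ^ 2 * ‖xp - x‖ ^ 2 := by
    simpa using (le_add_of_nonneg_left (sq_nonneg _)).trans (hLip xp y x y)
  have hsplit : ‖gy xp y - v‖ ^ 2 ≤ 2 * (‖gy xp y - gy x y‖ ^ 2 + ‖gy x y - v‖ ^ 2) :=
    (pow_le_pow_left₀ (norm_nonneg _) (norm_sub_le_norm_sub_add_norm_sub _ _ _) 2).trans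
      add_sq_le
  have hinner : μ * (Φ xp - G xp y) + ‖v‖ ^ 2 / 2
      - (L_f ^ 2 * ‖xp - x‖ ^ 2 + ‖gy x y - v‖ ^ 2) ≤ ⟪gy xp y, v⟫ := by
    linarith [hPL xp y]
  have := mul_le_mul_of_nonneg_left hinner (mul_pos hc hη).le
  linarith
end

section
/- Let E and F be finite-dimensional real inner product spaces, let F : E × F → ℝ be differentiable with L_f-Lipschitz gradient, and let Φ : E → ℝ be differentiable with L-Lipschitz gradient, where L ≥ L_f. Fix x ∈ E and y ∈ F and suppose ‖∇_x F(x,y) − ∇Φ(x)‖² ≤ (2L_f²/μ)(Φ(x) − F(x,y)) for some μ > 0. Then for any x̂ ∈ E and constants η, ĉ > 0, setting x⁺ = x + η(x̂ − x), one has F(x,y) − F(x⁺, y) ≤ (4ĉηL_f²/μ)(Φ(x) − F(x,y)) + Φ(x) − Φ(x⁺) + (η²L + η/(8ĉ))‖x̂ − x‖². -/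
open Set in
/-- The descent lemma: a function with `L`-Lipschitz gradient is bounded above by its quadratic
model. -/
theorem HasGradientAt.sub_le_inner_add_sq {E : Type*} [NormedAddCommGroup E]
    [InnerProductSpace ℝ E] [CompleteSpace E] {f : E → ℝ} {g : E → E} {L : ℝ}
    (hf : ∀ z, HasGradientAt f (g z) z) (hg : ∀ z₁ z₂, ‖g z₁ - g z₂‖ ≤ L * ‖z₁ - z₂‖)
    (x d : E) : f (x + d) - f x ≤ inner ℝ (g x) d + L / 2 * ‖d‖ ^ 2 := by
  have hderiv : ∀ t : ℝ, HasDerivAt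
      (fun t : ℝ => f (x + t • d) - t * inner ℝ (g x) d - L / 2 * ‖d‖ ^ 2 * t ^ 2)
      (inner ℝ (g (x + t • d)) d - inner ℝ (g x) d - L * t * ‖d‖ ^ 2) t := by
    intro t
    have hline : HasDerivAt (fun t : ℝ => x + t • d) d t := by
      simpa using ((hasDerivAt_id t).smul_const d).const_add x
    have hcomp : HasDerivAt (fun t : ℝ => f (x + t • d)) (inner ℝ (g (x + t • d)) d) t := by
      have h := (hf (x + t • d)).hasFDerivAt.comp_hasDerivAt t hline
      rwa [InnerProductSpace.toDual_apply_apply] at h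
    refine ((hcomp.sub ((hasDerivAt_id t).mul_const (inner ℝ (g x) d))).sub
      ((hasDerivAt_pow 2 t).const_mul (L / 2 * ‖d‖ ^ 2))).congr_deriv ?_
    simp only [one_mul, Nat.cast_ofNat, Nat.add_one_sub_one, pow_one]
    ring
  have hanti : AntitoneOn
      (fun t : ℝ => f (x + t • d) - t * inner ℝ (g x) d - L / 2 * ‖d‖ ^ 2 * t ^ 2) (Icc 0 1) := by
    refine antitoneOn_of_hasDerivWithinAt_nonpos (convex_Icc 0 1)
      (fun t _ => (hderiv t).continuousAt.continuousWithinAt)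
      (fun t _ => (hderiv t).hasDerivWithinAt) fun t ht => ?_
    have ht0 : 0 ≤ t := (interior_subset ht).1
    have hinner : inner ℝ (g (x + t • d) - g x) d ≤ L * t * ‖d‖ ^ 2 := by
      calc inner ℝ (g (x + t • d) - g x) d ≤ ‖g (x + t • d) - g x‖ * ‖d‖ := real_inner_le_norm _ _
        _ ≤ L * ‖x + t • d - x‖ * ‖d‖ := by gcongr; exact hg _ _
        _ = L * t * ‖d‖ ^ 2 := by
          rw [add_sub_cancel_left, norm_smul, Real.norm_of_nonneg ht0]
          ring
    rw [inner_sub_left] at hinner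
    linarith
  have h := hanti (left_mem_Icc.2 zero_le_one) (right_mem_Icc.2 zero_le_one) zero_le_one
  simp only [one_smul, zero_smul, add_zero] at h
  linarith


/-- One-step bound on `F(x,y) - F(x⁺,y)` for the move `x⁺ = x + η(x̂ - x)`: under
`L_f`-smoothness of `F`, `L`-smoothness of `Φ` with `L ≥ L_f`, and the gap bound
`‖∇ₓF(x,y) - ∇Φ(x)‖² ≤ (2L_f²/μ)(Φ(x) - F(x,y))`, one has
`F(x,y) - F(x⁺,y) ≤ (4chatηL_f²/μ)(Φ(x) - F(x,y)) + Φ(x) - Φ(x⁺) + (η²L + η/(8chat))‖x̂ - x‖²`. -/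
theorem one_step_x_move_bound
    {E F : Type*} [NormedAddCommGroup E] [InnerProductSpace ℝ E] [FiniteDimensional ℝ E]
    [NormedAddCommGroup F] [InnerProductSpace ℝ F] [FiniteDimensional ℝ F]
    (G : E → F → ℝ) (gx : E → F → E) (gy : E → F → F) (L_f L μ : ℝ)
    (hLf : 0 < L_f) (hμ : 0 < μ) (hLfL : L_f ≤ L)
    (hgx : ∀ x y, HasGradientAt (fun x' => G x' y) (gx x y) x)
    (hgy : ∀ x y, HasGradientAt (fun y' => G x y') (gy x y) y)
    (hLip : ∀ x₁ y₁ x₂ y₂, ‖gx x₁ y₁ - gx x₂ y₂‖ ^ 2 + ‖gy x₁ y₁ - gy x₂ y₂‖ ^ 2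
      ≤ L_f ^ 2 * (‖x₁ - x₂‖ ^ 2 + ‖y₁ - y₂‖ ^ 2))
    (Φ : E → ℝ) (gΦ : E → E)
    (hΦgrad : ∀ z, HasGradientAt Φ (gΦ z) z)
    (hΦLip : ∀ z₁ z₂, ‖gΦ z₁ - gΦ z₂‖ ≤ L * ‖z₁ - z₂‖)
    (x : E) (y : F)
    (hgap : ‖gx x y - gΦ x‖ ^ 2 ≤ 2 * L_f ^ 2 / μ * (Φ x - G x y)) :
    ∀ (xh : E) (η chat : ℝ), 0 < η → 0 < chat →
      G x y - G (x + η • (xh - x)) y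
        ≤ 4 * chat * η * L_f ^ 2 / μ * (Φ x - G x y)
          + (Φ x - Φ (x + η • (xh - x)))
          + (η ^ 2 * L + η / (8 * chat)) * ‖xh - x‖ ^ 2 := by
  intro xh η c hη hc
  have hgxLip : ∀ z₁ z₂, ‖-gx z₁ y - -gx z₂ y‖ ≤ L_f * ‖z₁ - z₂‖ := by
    intro z₁ z₂
    rw [neg_sub_neg, norm_sub_rev]
    refine le_of_abs_le (abs_le_of_sq_le_sq ?_ (by positivity))
    have h := hLip z₁ y z₂ y
    rw [sub_self, norm_zero] at h
    nlinarith [sq_nonneg ‖gy z₁ y - gy z₂ y‖]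
  have hneg : ∀ z, HasGradientAt (fun x' => -G x' y) (-gx z y) z := fun z => by
    rw [hasGradientAt_iff_hasFDerivAt, map_neg]
    exact (hgx z y).hasFDerivAt.neg
  have hG := HasGradientAt.sub_le_inner_add_sq hneg hgxLip x (η • (xh - x))
  have hΦ := HasGradientAt.sub_le_inner_add_sq hΦgrad hΦLip x (η • (xh - x))
  rw [norm_smul, Real.norm_of_nonneg hη.le, inner_smul_right] at hG hΦ
  rw [inner_neg_left] at hG
  have hinner : inner ℝ (gΦ x) (xh - x) - inner ℝ (gx x y) (xh - x)
      ≤ ‖gx x y - gΦ x‖ * ‖xh - x‖ := by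
    rw [← inner_sub_left, norm_sub_rev]
    exact real_inner_le_norm _ _
  have hyoung : ‖gx x y - gΦ x‖ * ‖xh - x‖
      ≤ 2 * c * ‖gx x y - gΦ x‖ ^ 2 + 1 / (8 * c) * ‖xh - x‖ ^ 2 := by
    have h : 2 * c * ‖gx x y - gΦ x‖ ^ 2 + 1 / (8 * c) * ‖xh - x‖ ^ 2
        - ‖gx x y - gΦ x‖ * ‖xh - x‖
        = (4 * c * ‖gx x y - gΦ x‖ - ‖xh - x‖) ^ 2 / (8 * c) := by
      field_simp
      ring
    have : 0 ≤ (4 * c * ‖gx x y - gΦ x‖ - ‖xh - x‖) ^ 2 / (8 * c) := by positivity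
    linarith
  have hcross := mul_le_mul_of_nonneg_left (hinner.trans hyoung) hη.le
  have hgap' := mul_le_mul_of_nonneg_left hgap (by positivity : 0 ≤ 2 * c * η)
  have hL := mul_le_mul_of_nonneg_right hLfL (by positivity : 0 ≤ (η * ‖xh - x‖) ^ 2)
  have hgap_eq : 4 * c * η * L_f ^ 2 / μ * (Φ x - G x y)
      = 2 * c * η * (2 * L_f ^ 2 / μ * (Φ x - G x y)) := by ring
  have hcoef : (η ^ 2 * L + η / (8 * c)) * ‖xh - x‖ ^ 2
      = L * (η * ‖xh - x‖) ^ 2 + η * (1 / (8 * c) * ‖xh - x‖ ^ 2) := by ring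
  rw [hgap_eq, hcoef]
  linarith
end

section
/- Let E and F be finite-dimensional real inner product spaces, let F : E × F → ℝ be differentiable with L_f-Lipschitz gradient, and let Φ(x) = sup_{y′} F(x,y′) be finite for every x. Fix x ∈ E and let x̂ be a minimizer of the function z ↦ Φ(z) + L_f‖z − x‖². Then for every y ∈ F, ⟨x̂ − x, ∇_x F(x,y)⟩ ≤ Φ(x) − F(x,y) − (L_f/2)‖x̂ − x‖². -/
open RealInnerProductSpace

/-- The quadratic lower bound for a function whose gradient is `L`-Lipschitz around `x`. -/
theorem add_inner_sub_le_of_hasGradientAt_of_norm_sub_le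
    {E : Type*} [NormedAddCommGroup E] [InnerProductSpace ℝ E] [CompleteSpace E]
    {f : E → ℝ} {g : E → E} {L : ℝ} {x : E}
    (hf : ∀ z, HasGradientAt f (g z) z) (hg : ∀ z, ‖g z - g x‖ ≤ L * ‖z - x‖) (z : E) :
    f x + ⟪g x, z - x⟫ - L / 2 * ‖z - x‖ ^ 2 ≤ f z := by
  set d := z - x with hd
  let φ : ℝ → ℝ := fun t => f (x + t • d) - t * ⟪g x, d⟫ + L / 2 * ‖d‖ ^ 2 * t ^ 2
  have hφ (t : ℝ) :
      HasDerivAt φ (⟪g (x + t • d), d⟫ - ⟪g x, d⟫ + L * ‖d‖ ^ 2 * t) t := by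
    have hline : HasDerivAt (fun s : ℝ => x + s • d) d t := by
      simpa using ((hasDerivAt_id t).smul_const d).const_add x
    have hcomp : HasDerivAt (fun s : ℝ => f (x + s • d)) ⟪g (x + t • d), d⟫ t := by
      exact ((hf (x + t • d)).hasFDerivAt.comp_hasDerivAt t hline).congr_deriv (by simp)
    refine ((hcomp.sub ((hasDerivAt_id t).mul_const ⟪g x, d⟫)).add
      ((hasDerivAt_pow 2 t).const_mul (L / 2 * ‖d‖ ^ 2))).congr_deriv ?_
    norm_num
    ring
  have hmono : MonotoneOn φ (Set.Ici 0) := by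
    refine monotoneOn_of_deriv_nonneg (convex_Ici 0)
      (fun t _ => (hφ t).continuousAt.continuousWithinAt)
      (fun t _ => (hφ t).differentiableAt.differentiableWithinAt) fun t ht => ?_
    rw [interior_Ici, Set.mem_Ioi] at ht
    rw [(hφ t).deriv, ← inner_sub_left]
    have hinner := (abs_le.mp (abs_real_inner_le_norm (g (x + t • d) - g x) d)).1
    have hnorm : ‖g (x + t • d) - g x‖ ≤ L * (t * ‖d‖) := by
      simpa [norm_smul, abs_of_pos ht] using hg (x + t • d)
    have := mul_le_mul_of_nonneg_right hnorm (norm_nonneg d)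
    linarith
  have h01 := hmono Set.self_mem_Ici (Set.mem_Ici.mpr zero_le_one) zero_le_one
  simp only [φ, hd, zero_smul, one_smul, add_zero, add_sub_cancel] at h01
  linarith

/-- Moreau-envelope proximal point inequality: if `x̂` minimizes `z ↦ Φ(z) + L_f‖z - x‖²`
with `Φ(x) = sup_y F(x,y)` and `F` is `L_f`-smooth, then for every `y`,
`⟨x̂ - x, ∇ₓF(x,y)⟩ ≤ Φ(x) - F(x,y) - (L_f/2)‖x̂ - x‖²`. -/
theorem prox_point_inner_le_gap
    {E F : Type*} [NormedAddCommGroup E] [InnerProductSpace ℝ E] [FiniteDimensional ℝ E]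
    [NormedAddCommGroup F] [InnerProductSpace ℝ F] [FiniteDimensional ℝ F]
    (G : E → F → ℝ) (gx : E → F → E) (gy : E → F → F) (L_f : ℝ) (hLf : 0 < L_f)
    (hgx : ∀ x y, HasGradientAt (fun x' => G x' y) (gx x y) x)
    (hgy : ∀ x y, HasGradientAt (fun y' => G x y') (gy x y) y)
    (hLip : ∀ x₁ y₁ x₂ y₂, ‖gx x₁ y₁ - gx x₂ y₂‖ ^ 2 + ‖gy x₁ y₁ - gy x₂ y₂‖ ^ 2
      ≤ L_f ^ 2 * (‖x₁ - x₂‖ ^ 2 + ‖y₁ - y₂‖ ^ 2))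
    (Φ : E → ℝ)
    (hbdd : ∀ x, BddAbove (Set.range (G x)))
    (hΦ : ∀ x, Φ x = ⨆ y, G x y)
    (x xh : E)
    (hmin : IsMinOn (fun z => Φ z + L_f * ‖z - x‖ ^ 2) Set.univ xh) :
    ∀ y, ⟪xh - x, gx x y⟫ ≤ Φ x - G x y - L_f / 2 * ‖xh - x‖ ^ 2 := by
  intro y
  have hg (z : E) : ‖gx z y - gx x y‖ ≤ L_f * ‖z - x‖ := by
    refine (sq_le_sq₀ (norm_nonneg _) (by positivity)).mp ?_
    have := hLip z y x y
    simp only [sub_self, norm_zero] at this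
    rw [mul_pow]
    linarith [sq_nonneg ‖gy z y - gy x y‖]
  have hlower := add_inner_sub_le_of_hasGradientAt_of_norm_sub_le (fun z => hgx z y) hg xh
  have hsup : G xh y ≤ Φ xh := hΦ xh ▸ le_ciSup (hbdd xh) y
  have hprox := isMinOn_iff.mp hmin x (Set.mem_univ x)
  simp only [sub_self, norm_zero] at hprox
  rw [real_inner_comm]
  linarith
end

section
/- Let E and F be finite-dimensional real inner product spaces, F : E × F → ℝ differentiable with L_f-Lipschitz gradient, Φ(x) = sup_y F(x,y) finite and differentiable with L-Lipschitz gradient where L ≥ L_f, and suppose: (PL) ‖∇_y F(x,y)‖² ≥ 2μ(Φ(x) − F(x,y)) for all x, y; (gap) ‖∇_x F(x,y) − ∇Φ(x)‖² ≤ (2L_f²/μ)(Φ(x) − F(x,y)) for all x, y. Set κ = L_f/μ and let ĉ, c, η > 0 satisfy ĉ ≤ c/(8κ²), ĉηL ≤ 1/20, and cηL_f ≤ 1/20. Then for any x ∈ E, y ∈ F, u ∈ E, v ∈ F, with x⁺ = x − ĉηu and y⁺ = y + cηv: [Φ(x⁺) − F(x⁺, y⁺)] − [Φ(x) − F(x,y)]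 ≤ −(cημ/2)(Φ(x) − F(x,y)) + (ηĉ/4)‖u‖² − (ηc/4)‖v‖² + cη‖∇_y F(x,y) − v‖². -/
open RealInnerProductSpace

/-- The descent lemma: a function whose gradient is `K`-Lipschitz lies below its quadratic
upper model. -/
lemma le_quadratic_of_lipschitz_gradient {E : Type*} [NormedAddCommGroup E]
    [InnerProductSpace ℝ E] [CompleteSpace E] {f : E → ℝ} {g : E → E} {K : ℝ}
    (hf : ∀ z, HasGradientAt f (g z) z) (hg : ∀ z w, ‖g z - g w‖ ≤ K * ‖z - w‖) (x d : E) :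
    f (x + d) ≤ f x + inner ℝ (g x) d + K / 2 * ‖d‖ ^ 2 := by
  let φ : ℝ → ℝ := fun t => f (x + t • d) - t * inner ℝ (g x) d - K / 2 * ‖d‖ ^ 2 * t ^ 2
  have hφ (t : ℝ) : HasDerivAt φ
      (inner ℝ (g (x + t • d)) d - inner ℝ (g x) d - K * ‖d‖ ^ 2 * t) t := by
    have hline : HasDerivAt (fun s : ℝ => x + s • d) d t := by
      simpa using ((hasDerivAt_id t).smul_const d).const_add x
    have hcomp := (hf (x + t • d)).hasFDerivAt.comp_hasDerivAt t hline
    have h := (hcomp.sub ((hasDerivAt_id t).mul_const (inner ℝ (g x) d))).sub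
      (((hasDerivAt_id t).pow 2).const_mul (K / 2 * ‖d‖ ^ 2))
    refine HasDerivAt.congr_deriv (f := φ) h ?_
    simp
    ring
  have hanti : AntitoneOn φ (Set.Icc 0 1) := by
    refine antitoneOn_of_deriv_nonpos (convex_Icc 0 1)
      (fun t _ => (hφ t).continuousAt.continuousWithinAt)
      (fun t _ => (hφ t).differentiableAt.differentiableWithinAt) fun t ht => ?_
    rw [interior_Icc] at ht
    have hlip := hg (x + t • d) x
    rw [add_sub_cancel_left, norm_smul, Real.norm_of_nonneg ht.1.le] at hlip
    have hinner := real_inner_le_norm (g (x + t • d) - g x) d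
    rw [inner_sub_left] at hinner
    rw [(hφ t).deriv]
    nlinarith [mul_le_mul_of_nonneg_right hlip (norm_nonneg d)]
  have h := hanti (Set.left_mem_Icc.2 zero_le_one) (Set.right_mem_Icc.2 zero_le_one) zero_le_one
  simp only [φ, one_smul, zero_smul, add_zero] at h
  linarith

/-- The lower quadratic model of a function with `K`-Lipschitz gradient. -/
lemma quadratic_le_of_lipschitz_gradient {E : Type*} [NormedAddCommGroup E]
    [InnerProductSpace ℝ E] [CompleteSpace E] {f : E → ℝ} {g : E → E} {K : ℝ}
    (hf : ∀ z, HasGradientAt f (g z) z) (hg : ∀ z w, ‖g z - g w‖ ≤ K * ‖z - w‖) (x d : E) :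
    f x + inner ℝ (g x) d - K / 2 * ‖d‖ ^ 2 ≤ f (x + d) := by
  have h := le_quadratic_of_lipschitz_gradient (f := fun z => -f z) (g := fun z => -g z) (K := K)
    (fun z => by
      rw [hasGradientAt_iff_hasFDerivAt, map_neg]
      exact (hf z).hasFDerivAt.neg)
    (fun z w => by rw [← neg_sub', norm_neg]; exact hg z w) x d
  rw [inner_neg_left] at h
  linarith

/-- One-step decrease of the duality-gap potential `Φ(x) - F(x,y)` under the simultaneous
inexact descent–ascent updates `x⁺ = x - ĉηu`, `y⁺ = y + cηv`, for `L_f`-smooth `F`,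
`L`-smooth `Φ` with `L ≥ L_f`, the `μ`-PL condition in `y`, the gradient-gap bound, and
step sizes with `ĉ ≤ c/(8κ²)`, `ĉηL ≤ 1/20`, `cηL_f ≤ 1/20`, where `κ = L_f/μ`. -/
theorem one_step_gap_potential_decrease
    {E F : Type*} [NormedAddCommGroup E] [InnerProductSpace ℝ E] [FiniteDimensional ℝ E]
    [NormedAddCommGroup F] [InnerProductSpace ℝ F] [FiniteDimensional ℝ F]
    (G : E → F → ℝ) (gx : E → F → E) (gy : E → F → F) (L_f L μ κ : ℝ)
    (hLf : 0 < L_f) (hμ : 0 < μ) (hLfL : L_f ≤ L) (hκ : κ = L_f / μ)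
    (hgx : ∀ x y, HasGradientAt (fun x' => G x' y) (gx x y) x)
    (hgy : ∀ x y, HasGradientAt (fun y' => G x y') (gy x y) y)
    (hLip : ∀ x₁ y₁ x₂ y₂, ‖gx x₁ y₁ - gx x₂ y₂‖ ^ 2 + ‖gy x₁ y₁ - gy x₂ y₂‖ ^ 2
      ≤ L_f ^ 2 * (‖x₁ - x₂‖ ^ 2 + ‖y₁ - y₂‖ ^ 2))
    (Φ : E → ℝ) (gΦ : E → E)
    (hbdd : ∀ x, BddAbove (Set.range (G x)))
    (hΦ : ∀ x, Φ x = ⨆ y, G x y)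
    (hΦgrad : ∀ z, HasGradientAt Φ (gΦ z) z)
    (hΦLip : ∀ z₁ z₂, ‖gΦ z₁ - gΦ z₂‖ ≤ L * ‖z₁ - z₂‖)
    (hPL : ∀ x y, 2 * μ * (Φ x - G x y) ≤ ‖gy x y‖ ^ 2)
    (hgap : ∀ x y, ‖gx x y - gΦ x‖ ^ 2 ≤ 2 * L_f ^ 2 / μ * (Φ x - G x y))
    (chat c η : ℝ) (hchat : 0 < chat) (hc : 0 < c) (hη : 0 < η)
    (hchatc : chat ≤ c / (8 * κ ^ 2))
    (hchatηL : chat * η * L ≤ 1 / 20)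
    (hcηLf : c * η * L_f ≤ 1 / 20) :
    ∀ (x : E) (y : F) (u : E) (v : F),
      (Φ (x - (chat * η) • u) - G (x - (chat * η) • u) (y + (c * η) • v))
          - (Φ x - G x y)
        ≤ -(c * η * μ / 2) * (Φ x - G x y) + η * chat / 4 * ‖u‖ ^ 2
          - η * c / 4 * ‖v‖ ^ 2 + c * η * ‖gy x y - v‖ ^ 2 := by
  intro x y u v
  have hlip_x (y : F) (z w : E) : ‖gx z y - gx w y‖ ≤ L_f * ‖z - w‖ := by
    refine le_of_sq_le_sq ?_ (by positivity)
    have h := hLip z y w y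
    simp only [sub_self, norm_zero] at h
    nlinarith [sq_nonneg ‖gy z y - gy w y‖]
  have hlip_y (x : E) (z w : F) : ‖gy x z - gy x w‖ ≤ L_f * ‖z - w‖ := by
    refine le_of_sq_le_sq ?_ (by positivity)
    have h := hLip x z x w
    simp only [sub_self, norm_zero] at h
    nlinarith [sq_nonneg ‖gx x z - gx x w‖]
  have hlip_xy : ‖gx x (y + (c * η) • v) - gx x y‖ ≤ L_f * (c * η * ‖v‖) := by
    refine le_of_sq_le_sq ?_ (by positivity)
    have h := hLip x (y + (c * η) • v) x y
    rw [add_sub_cancel_left, norm_smul, Real.norm_of_nonneg (by positivity)] at h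
    simp only [sub_self, norm_zero] at h
    nlinarith [sq_nonneg ‖gy x (y + (c * η) • v) - gy x y‖]
  have hΦ_step := le_quadratic_of_lipschitz_gradient hΦgrad hΦLip x (-((chat * η) • u))
  have hy_step := quadratic_le_of_lipschitz_gradient (hgy x) (hlip_y x) y ((c * η) • v)
  have hx_step := quadratic_le_of_lipschitz_gradient (fun z => hgx z (y + (c * η) • v))
    (hlip_x (y + (c * η) • v)) x (-((chat * η) • u))
  have hgap_nonneg : 0 ≤ Φ x - G x y := by
    rw [hΦ, sub_nonneg]
    exact le_ciSup (hbdd x) y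
  have hPLxy := hPL x y
  have hgapxy := hgap x y
  have hchat_gap : chat * η * ‖gx x y - gΦ x‖ ^ 2 ≤ c * η * μ / 4 * (Φ x - G x y) := by
    have hκ_pos : 0 < κ := hκ ▸ div_pos hLf hμ
    rw [le_div_iff₀ (by positivity)] at hchatc
    have hcoef : 2 * L_f ^ 2 / μ = 2 * κ ^ 2 * μ := by
      rw [hκ]
      field_simp
    rw [hcoef] at hgapxy
    calc chat * η * ‖gx x y - gΦ x‖ ^ 2
        ≤ chat * η * (2 * κ ^ 2 * μ * (Φ x - G x y)) := by gcongr
      _ = chat * (8 * κ ^ 2) * (η * μ / 4 * (Φ x - G x y)) := by ring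
      _ ≤ c * (η * μ / 4 * (Φ x - G x y)) := by gcongr
      _ = c * η * μ / 4 * (Φ x - G x y) := by ring
  simp only [norm_neg, norm_smul, inner_neg_right, inner_smul_right, ← sub_eq_add_neg,
    Real.norm_of_nonneg (mul_pos hchat hη).le, Real.norm_of_nonneg (mul_pos hc hη).le]
    at hΦ_step hy_step hx_step
  have ha : 0 < chat * η := by positivity
  have hb : 0 < c * η := by positivity
  have hcross : inner ℝ (gx x (y + (c * η) • v)) u - inner ℝ (gx x y) u
      ≤ L_f * (c * η * ‖v‖) * ‖u‖ := by
    rw [← inner_sub_left]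
    exact (real_inner_le_norm _ _).trans (by gcongr)
  have hyoung : inner ℝ (gx x y) u - inner ℝ (gΦ x) u
      ≤ 2 * ‖gx x y - gΦ x‖ ^ 2 + 1 / 8 * ‖u‖ ^ 2 := by
    rw [← inner_sub_left]
    nlinarith [real_inner_le_norm (gx x y - gΦ x) u, sq_nonneg (4 * ‖gx x y - gΦ x‖ - ‖u‖)]
  have hpolar := norm_sub_sq_real (gy x y) v
  rw [show η * chat = chat * η by ring, show η * c = c * η by ring]
  generalize chat * η = a at *
  generalize c * η = b at *
  have hcross' := mul_le_mul_of_nonneg_left hcross ha.le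
  have hyoung' := mul_le_mul_of_nonneg_left hyoung ha.le
  have hPL' := mul_le_mul_of_nonneg_left hPLxy hb.le
  have hpolar' := congrArg (b * ·) hpolar
  have hamgm : a * (L_f * (b * ‖v‖) * ‖u‖) ≤ L_f / 2 * ((a * ‖u‖) ^ 2 + (b * ‖v‖) ^ 2) := by
    linarith [mul_nonneg hLf.le (sq_nonneg (a * ‖u‖ - b * ‖v‖))]
  have hLu : L * (a * ‖u‖) ^ 2 ≤ 1 / 20 * a * ‖u‖ ^ 2 := by
    linarith [mul_le_mul_of_nonneg_right hchatηL (mul_nonneg ha.le (sq_nonneg ‖u‖))]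
  have hLfu : L_f * (a * ‖u‖) ^ 2 ≤ L * (a * ‖u‖) ^ 2 := by gcongr
  have hLfv : L_f * (b * ‖v‖) ^ 2 ≤ 1 / 20 * b * ‖v‖ ^ 2 := by
    linarith [mul_le_mul_of_nonneg_right hcηLf (mul_nonneg hb.le (sq_nonneg ‖v‖))]
  have hau : 0 ≤ a * ‖u‖ ^ 2 := by positivity
  have hbv : 0 ≤ b * ‖v‖ ^ 2 := by positivity
  have hbqv : 0 ≤ b * ‖gy x y - v‖ ^ 2 := by positivity
  linarith
end

section
/- Let E and F be finite-dimensional real inner product spaces, let f₁, …, f_N : E × F → ℝ be differentiable with L_f-Lipschitz gradients, let F = (1/N)∑_{i=1}^N f_i, and let Φ : E → ℝ be differentiable with L-Lipschitz gradient such that ‖∇Φ(x) − ∇_x F(x,y)‖² ≤ (2L_f²/μ)(Φ(x) − F(x,y)) for all x, y, for some μ > 0. Let x₁, …, x_N ∈ E, y₁, …, y_N ∈ F with means x̄ = (1/N)∑_i x_i, ȳ = (1/N)∑_i y_i, let ū ∈ E, and set x̄⁺ = x̄ − ĉηū for constants ĉ, η > 0. Then Φ(x̄⁺) ≤ Φ(x̄)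 − (ĉη/2 − ĉ²η²L/2)‖ū‖² − (ĉη/2)‖∇Φ(x̄)‖² + (3ĉη/2)‖ū − (1/N)∑_{i=1}^N ∇_x f_i(x_i, y_i)‖² + (3ĉηL_f²/(2N))∑_{i=1}^N (‖x_i − x̄‖² + ‖y_i − ȳ‖²) + (3ĉηL_f²/μ)(Φ(x̄) − F(x̄, ȳ)). -/
/-- The descent lemma for a function with `L`-Lipschitz gradient. -/
theorem le_add_inner_add_of_lipschitz_gradient
    {E : Type*} [NormedAddCommGroup E] [InnerProductSpace ℝ E] [CompleteSpace E]
    {φ : E → ℝ} {g : E → E} {L : ℝ} (hφ : ∀ z, HasGradientAt φ (g z) z)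
    (hg : ∀ z₁ z₂, ‖g z₁ - g z₂‖ ≤ L * ‖z₁ - z₂‖) (x d : E) :
    φ (x + d) ≤ φ x + inner ℝ (g x) d + L / 2 * ‖d‖ ^ 2 := by
  have hder : ∀ t : ℝ, HasDerivAt
      (fun t : ℝ => φ (x + t • d) - (t * inner ℝ (g x) d + t ^ 2 * (L / 2 * ‖d‖ ^ 2)))
      (inner ℝ (g (x + t • d)) d - (inner ℝ (g x) d + 2 * t * (L / 2 * ‖d‖ ^ 2))) t := by
    intro t
    have hline : HasDerivAt (fun t : ℝ => x + t • d) d t := by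
      simpa using ((hasDerivAt_id t).smul_const d).const_add x
    have hcomp : HasDerivAt (fun t : ℝ => φ (x + t • d)) (inner ℝ (g (x + t • d)) d) t := by
      simpa [Function.comp_def] using (hφ (x + t • d)).hasFDerivAt.comp_hasDerivAt t hline
    refine hcomp.sub (HasDerivAt.add ?_ ?_)
    · simpa using (hasDerivAt_id t).mul_const (inner ℝ (g x) d)
    · simpa using (hasDerivAt_pow 2 t).mul_const (L / 2 * ‖d‖ ^ 2)
  have hanti := antitoneOn_of_deriv_nonpos (convex_Icc (0 : ℝ) 1)
    (fun t _ => (hder t).continuousAt.continuousWithinAt)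
    (fun t _ => (hder t).differentiableAt.differentiableWithinAt)
    (fun t ht => by
      rw [interior_Icc] at ht
      rw [(hder t).deriv]
      have hinner : inner ℝ (g (x + t • d) - g x) d ≤ L * (t * ‖d‖) * ‖d‖ := by
        refine (real_inner_le_norm _ _).trans (mul_le_mul_of_nonneg_right ?_ (norm_nonneg d))
        simpa [norm_smul, abs_of_pos ht.1] using hg (x + t • d) x
      rw [inner_sub_left] at hinner
      linarith)
  have h := hanti (Set.left_mem_Icc.2 zero_le_one) (Set.right_mem_Icc.2 zero_le_one) zero_le_one
  simp only [one_smul, zero_smul, add_zero] at h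
  linarith

theorem norm_add_add_sq_le {E : Type*} [SeminormedAddCommGroup E] (a b c : E) :
    ‖a + b + c‖ ^ 2 ≤ 3 * (‖a‖ ^ 2 + ‖b‖ ^ 2 + ‖c‖ ^ 2) := by
  have h := pow_le_pow_left₀ (norm_nonneg _) (norm_add₃_le (a := a) (b := b) (c := c)) 2
  nlinarith [sq_nonneg (‖a‖ - ‖b‖), sq_nonneg (‖b‖ - ‖c‖), sq_nonneg (‖a‖ - ‖c‖)]

/-- Jensen's inequality for the squared norm of an average. -/
theorem norm_inv_smul_sum_sq_le {E : Type*} [SeminormedAddCommGroup E] [NormedSpace ℝ E]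
    {N : ℕ} (v : Fin N → E) :
    ‖(N : ℝ)⁻¹ • ∑ i, v i‖ ^ 2 ≤ (N : ℝ)⁻¹ * ∑ i, ‖v i‖ ^ 2 := by
  rcases Nat.eq_zero_or_pos N with rfl | hN
  · simp
  have hN' : (0 : ℝ) < N := by exact_mod_cast hN
  have hsum : ‖∑ i, v i‖ ^ 2 ≤ N * ∑ i, ‖v i‖ ^ 2 := by
    refine (pow_le_pow_left₀ (norm_nonneg _) (norm_sum_le _ _) 2).trans ?_
    simpa using sq_sum_le_card_mul_sum_sq (s := Finset.univ) (f := fun i => ‖v i‖)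
  rw [norm_smul, mul_pow, Real.norm_of_nonneg (inv_nonneg.2 hN'.le)]
  calc (N : ℝ)⁻¹ ^ 2 * ‖∑ i, v i‖ ^ 2 ≤ (N : ℝ)⁻¹ ^ 2 * (N * ∑ i, ‖v i‖ ^ 2) := by gcongr
    _ = (N : ℝ)⁻¹ * ∑ i, ‖v i‖ ^ 2 := by field_simp


/-- Per-iteration descent inequality for the averaged x-update `x̄⁺ = x̄ - ĉηū` of FedSGDA-M,
with node-specific evaluation points `(x_i, y_i)` and inexact averaged direction `ū`. -/
theorem averaged_x_update_descent
    {E F : Type*} [NormedAddCommGroup E] [InnerProductSpace ℝ E] [FiniteDimensional ℝ E]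
    [NormedAddCommGroup F] [InnerProductSpace ℝ F] [FiniteDimensional ℝ F]
    {N : ℕ} (hN : 0 < N)
    (f : Fin N → E → F → ℝ) (gxi : Fin N → E → F → E) (gyi : Fin N → E → F → F)
    (L_f L μ : ℝ) (hLf : 0 < L_f) (hμ : 0 < μ)
    (hgx : ∀ i x y, HasGradientAt (fun x' => f i x' y) (gxi i x y) x)
    (hgy : ∀ i x y, HasGradientAt (fun y' => f i x y') (gyi i x y) y)
    (hLip : ∀ i x₁ y₁ x₂ y₂,
      ‖gxi i x₁ y₁ - gxi i x₂ y₂‖ ^ 2 + ‖gyi i x₁ y₁ - gyi i x₂ y₂‖ ^ 2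
        ≤ L_f ^ 2 * (‖x₁ - x₂‖ ^ 2 + ‖y₁ - y₂‖ ^ 2))
    (Φ : E → ℝ) (gΦ : E → E)
    (hΦgrad : ∀ z, HasGradientAt Φ (gΦ z) z)
    (hΦLip : ∀ z₁ z₂, ‖gΦ z₁ - gΦ z₂‖ ≤ L * ‖z₁ - z₂‖)
    (hgap : ∀ (x : E) (y : F),
      ‖gΦ x - (N : ℝ)⁻¹ • ∑ i, gxi i x y‖ ^ 2
        ≤ 2 * L_f ^ 2 / μ * (Φ x - (N : ℝ)⁻¹ * ∑ i, f i x y))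
    (xv : Fin N → E) (yv : Fin N → F) (ubar : E) (chat η : ℝ)
    (hchat : 0 < chat) (hη : 0 < η) :
    Φ ((N : ℝ)⁻¹ • ∑ i, xv i - (chat * η) • ubar)
      ≤ Φ ((N : ℝ)⁻¹ • ∑ i, xv i)
        - (chat * η / 2 - chat ^ 2 * η ^ 2 * L / 2) * ‖ubar‖ ^ 2
        - chat * η / 2 * ‖gΦ ((N : ℝ)⁻¹ • ∑ i, xv i)‖ ^ 2
        + 3 * chat * η / 2 * ‖ubar - (N : ℝ)⁻¹ • ∑ i, gxi i (xv i) (yv i)‖ ^ 2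
        + 3 * chat * η * L_f ^ 2 / (2 * N) *
            ∑ i, (‖xv i - (N : ℝ)⁻¹ • ∑ j, xv j‖ ^ 2 + ‖yv i - (N : ℝ)⁻¹ • ∑ j, yv j‖ ^ 2)
        + 3 * chat * η * L_f ^ 2 / μ *
            (Φ ((N : ℝ)⁻¹ • ∑ i, xv i)
              - (N : ℝ)⁻¹ * ∑ i, f i ((N : ℝ)⁻¹ • ∑ j, xv j) ((N : ℝ)⁻¹ • ∑ j, yv j)) := by
  have ha : 0 < chat * η := mul_pos hchat hη
  set xb := (N : ℝ)⁻¹ • ∑ i, xv i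
  set yb := (N : ℝ)⁻¹ • ∑ i, yv i
  set v := (N : ℝ)⁻¹ • ∑ i, gxi i (xv i) (yv i) with hv
  set w := (N : ℝ)⁻¹ • ∑ i, gxi i xb yb with hw
  have hdesc := le_add_inner_add_of_lipschitz_gradient hΦgrad hΦLip xb (-((chat * η) • ubar))
  rw [← sub_eq_add_neg, inner_neg_right, inner_smul_right, norm_neg, norm_smul, mul_pow,
    Real.norm_of_nonneg ha.le] at hdesc
  have hpolar := norm_sub_sq_real (gΦ xb) ubar
  have hsplit : ‖gΦ xb - ubar‖ ^ 2
      ≤ 3 * (‖ubar - v‖ ^ 2 + ‖v - w‖ ^ 2 + ‖gΦ xb - w‖ ^ 2) := by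
    have h := norm_add_add_sq_le (ubar - v) (v - w) (w - gΦ xb)
    rwa [sub_add_sub_cancel, sub_add_sub_cancel, norm_sub_rev ubar (gΦ xb),
      norm_sub_rev w (gΦ xb)] at h
  have hcons : ‖v - w‖ ^ 2
      ≤ (N : ℝ)⁻¹ * (L_f ^ 2 * ∑ i, (‖xv i - xb‖ ^ 2 + ‖yv i - yb‖ ^ 2)) := by
    rw [hv, hw, ← smul_sub, ← Finset.sum_sub_distrib, Finset.mul_sum]
    refine (norm_inv_smul_sum_sq_le _).trans ?_
    gcongr with i
    exact (le_add_of_nonneg_right (sq_nonneg _)).trans (hLip i (xv i) (yv i) xb yb)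
  have hbound := mul_le_mul_of_nonneg_left
    (hsplit.trans (mul_le_mul_of_nonneg_left
      (add_le_add (add_le_add_right hcons (‖ubar - v‖ ^ 2)) (hgap xb yb)) zero_le_three))
    (half_pos ha).le
  rw [hpolar] at hbound
  refine hdesc.trans ?_
  rw [← sub_nonneg] at hbound ⊢
  convert hbound using 1
  ring
end
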